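/- arXiv:1705.00924 — 2 statements merged into one kernel-verified Lean document; each statement's English description precedes it below -/
import Mathlib

section
/- For all reals a₁, a₂ with 0 ≤ a₁ ≤ a₂, a right isosceles (a₁, 0)-hat and a right isosceles (a₂, a₂−a₁)-hat can be packed into a closed square of side length (1+√2)·√((a₁+a₂)/π) (the square whose twincircle area equals a₁+a₂), i.e., there exist isometries g₁, g₂ of ℝ² mapping the two hats to subsets of the square whose interiors are disjoint. -/
noncomputable section

abbrev Plane := EuclideanSpace ℝ (Fin 2)

def pt (x y : ℝ) : Plane := (WithLp.equiv 2 (Fin 2 → ℝ)).symm ![x, y]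

/-- The union of all closed disks of radius `s` contained in `T`
(`T` with its corners rounded to radius `s`). -/
def roundCorners (s : ℝ) (T : Set Plane) : Set Plane :=
  ⋃ c ∈ {c : Plane | Metric.closedBall c s ⊆ T}, Metric.closedBall c s

/-- A closed isosceles right triangle whose incircle has area `a`:
right angle at the origin, legs of length `(2+√2)·√(a/π)` along the axes. -/
def rightIsoTriangle (a : ℝ) : Set Plane :=
  convexHull ℝ {pt 0 0, pt ((2 + Real.sqrt 2) * Real.sqrt (a / Real.pi)) 0,
    pt 0 ((2 + Real.sqrt 2) * Real.sqrt (a / Real.pi))}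

/-- The right isosceles `(a,b)`-hat: the isosceles right triangle with incircle area `a`,
with its corners rounded to the radius `√(b/π)` of a circle of area `b`. -/
def rightIsoHat (a b : ℝ) : Set Plane :=
  roundCorners (Real.sqrt (b / Real.pi)) (rightIsoTriangle a)

/-- The closed square `[0,L]²`. -/
def closedSquare (L : ℝ) : Set Plane :=
  {p | p 0 ∈ Set.Icc 0 L ∧ p 1 ∈ Set.Icc 0 L}

@[simp] lemma pt_zero (x y : ℝ) : pt x y 0 = x := rfl

@[simp] lemma pt_one (x y : ℝ) : pt x y 1 = y := rfl

lemma roundCorners_subset (s : ℝ) (T : Set Plane) : roundCorners s T ⊆ T :=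
  Set.iUnion₂_subset fun _ hc => hc

lemma rightIsoTriangle_bounds {a : ℝ} {p : Plane} (hp : p ∈ rightIsoTriangle a) :
    0 ≤ p 0 ∧ 0 ≤ p 1 ∧ p 0 + p 1 ≤ (2 + √2) * √(a / Real.pi) := by
  have hl : 0 ≤ (2 + √2) * √(a / Real.pi) := by positivity
  have hconv : Convex ℝ {p : Plane | 0 ≤ p 0 ∧ 0 ≤ p 1 ∧
      p 0 + p 1 ≤ (2 + √2) * √(a / Real.pi)} := by
    rintro x ⟨hx0, hx1, hx⟩ y ⟨hy0, hy1, hy⟩ u v hu hv huv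
    simp only [Set.mem_ofPred_eq, PiLp.add_apply, PiLp.smul_apply, smul_eq_mul]
    refine ⟨by positivity, by positivity, ?_⟩
    obtain rfl : v = 1 - u := by linarith
    nlinarith [mul_le_mul_of_nonneg_left hx hu, mul_le_mul_of_nonneg_left hy hv]
  refine convexHull_min ?_ hconv hp
  rintro q (rfl | rfl | rfl) <;> simp [hl]

lemma abs_apply_sub_le_dist (p q : Plane) (i : Fin 2) : |p i - q i| ≤ dist p q := by
  simpa [dist_eq_norm] using PiLp.norm_apply_le (p - q) i

/-- Rounding the corners to radius `s` shortens the legs by `√2 * s`. -/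
lemma apply_le_of_mem_roundCorners {s a : ℝ} (hs : 0 ≤ s) {p : Plane}
    (hp : p ∈ roundCorners s (rightIsoTriangle a)) (i : Fin 2) :
    p i ≤ (2 + √2) * √(a / Real.pi) - √2 * s := by
  obtain ⟨c, hc, hpc⟩ := Set.mem_iUnion₂.1 hp
  have hw : √2 ^ 2 = 2 := Real.sq_sqrt (by norm_num)
  have shifted (x y : ℝ) (hxy : x ^ 2 + y ^ 2 ≤ s ^ 2) := by
    refine rightIsoTriangle_bounds (hc (show c + pt x y ∈ Metric.closedBall c s from ?_))
    rw [Metric.mem_closedBall, dist_eq_norm, add_sub_cancel_left, EuclideanSpace.norm_eq]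
    refine Real.sqrt_le_iff.2 ⟨hs, ?_⟩
    simpa [Fin.sum_univ_two] using hxy
  simp only [PiLp.add_apply, pt_zero, pt_one] at shifted
  obtain ⟨-, -, hsum⟩ := shifted (√2 / 2 * s) (√2 / 2 * s) (by nlinarith)
  obtain ⟨hleft, -, -⟩ := shifted (-s) 0 (by nlinarith)
  obtain ⟨-, hdown, -⟩ := shifted 0 (-s) (by nlinarith)
  have hdist := (le_abs_self _).trans ((abs_apply_sub_le_dist p c i).trans hpc)
  fin_cases i <;> simp only [Fin.zero_eta, Fin.mk_one] at hdist ⊢ <;> linarith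

lemma disjoint_interior_of_sum_le {A B : Set Plane} {u v : ℝ} (huv : u ≤ v)
    (hA : ∀ p ∈ A, p 0 + p 1 ≤ u) (hB : ∀ p ∈ B, v ≤ p 0 + p 1) :
    Disjoint (interior A) (interior B) := by
  refine Set.disjoint_left.2 fun p hpA hpB => ?_
  have hlim : Filter.Tendsto (fun t : ℝ => p + t • pt 1 1) (nhdsWithin 0 (Set.Ioi 0))
      (nhds p) := by
    have hcont : Continuous fun t : ℝ => p + t • pt 1 1 := by fun_prop
    simpa using (hcont.tendsto 0).mono_left nhdsWithin_le_nhds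
  obtain ⟨t, htA, ht⟩ := ((hlim.eventually (mem_interior_iff_mem_nhds.1 hpA)).and
    self_mem_nhdsWithin).exists
  have hsum := hA _ htA
  have hp := hB p (interior_subset hpB)
  simp only [PiLp.add_apply, PiLp.smul_apply, pt_zero, pt_one, smul_eq_mul] at hsum
  have ht : 0 < t := ht
  linarith

lemma mul_le_one_add_sqrt_two_mul {r q R : ℝ} (hr : 0 ≤ r) (hrq : r ≤ q) (hR : 0 ≤ R)
    (hRsq : R ^ 2 = r ^ 2 + q ^ 2) : (2 + √2) * r ≤ (1 + √2) * R := by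
  have hw : √2 ^ 2 = 2 := Real.sq_sqrt (by norm_num)
  have hle : √2 * r ≤ R := abs_le_of_sq_le_sq' (by nlinarith) hR |>.2
  nlinarith [Real.sqrt_nonneg 2]

lemma mul_sub_le_one_add_sqrt_two_mul {r q R s : ℝ} (hr : 0 ≤ r) (hrq : r ≤ q) (hR : 0 ≤ R)
    (hs : 0 ≤ s) (hRsq : R ^ 2 = r ^ 2 + q ^ 2) (hssq : s ^ 2 = q ^ 2 - r ^ 2) :
    (2 + √2) * q - √2 * s ≤ (1 + √2) * R := by
  have hw : √2 ^ 2 = 2 := Real.sq_sqrt (by norm_num)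
  have hw1 : 1 ≤ √2 := Real.one_le_sqrt.2 (by norm_num)
  have hqR : q ≤ R := abs_le_of_sq_le_sq' (by nlinarith) hR |>.2
  have hsq : s ≤ q := abs_le_of_sq_le_sq' (by nlinarith) (hr.trans hrq) |>.2
  suffices (1 + √2) * (√2 * q - R) ≤ s by nlinarith
  rcases (hr.trans hrq).eq_or_lt with rfl | hq
  · nlinarith
  have hprod : (√2 * q - R) * (√2 * q + R) = s ^ 2 := by
    linear_combination q ^ 2 * hw - hRsq - hssq
  rcases le_total (√2 * q - R) 0 with hneg | hpos
  · nlinarith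
  have hbound : (√2 * q - R) * ((1 + √2) * q) ≤ s ^ 2 := by
    rw [← hprod]; gcongr; linarith
  refine le_of_mul_le_mul_right (?_ : _ ≤ s * q) hq
  nlinarith

lemma mul_add_le_two_mul_one_add_sqrt_two_mul {r q R : ℝ} (hR : 0 ≤ R)
    (hRsq : R ^ 2 = r ^ 2 + q ^ 2) :
    (2 + √2) * r + (2 + √2) * q ≤ 2 * ((1 + √2) * R) := by
  have hw : √2 ^ 2 = 2 := Real.sq_sqrt (by norm_num)
  have hle : r + q ≤ √2 * R :=
    abs_le_of_sq_le_sq' (by nlinarith [sq_nonneg (r - q)]) (by positivity) |>.2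
  nlinarith [Real.sqrt_nonneg 2]

/-- A right isosceles `(a₁,0)`-hat and a right isosceles `(a₂,a₂−a₁)`-hat can be packed
into a closed square of side length `(1+√2)·√((a₁+a₂)/π)`. -/
theorem right_hats_in_square (a₁ a₂ : ℝ) (h₁ : 0 ≤ a₁) (h₂ : a₁ ≤ a₂) :
    ∃ g₁ g₂ : Plane ≃ᵢ Plane,
      g₁ '' rightIsoHat a₁ 0 ⊆
        closedSquare ((1 + Real.sqrt 2) * Real.sqrt ((a₁ + a₂) / Real.pi)) ∧
      g₂ '' rightIsoHat a₂ (a₂ - a₁) ⊆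
        closedSquare ((1 + Real.sqrt 2) * Real.sqrt ((a₁ + a₂) / Real.pi)) ∧
      Disjoint (interior (g₁ '' rightIsoHat a₁ 0))
               (interior (g₂ '' rightIsoHat a₂ (a₂ - a₁))) := by
  have hπ := Real.pi_pos
  have ha₂ : 0 ≤ a₂ := h₁.trans h₂
  have hrq : √(a₁ / Real.pi) ≤ √(a₂ / Real.pi) := by gcongr
  have hrsq : √(a₁ / Real.pi) ^ 2 = a₁ / Real.pi := Real.sq_sqrt (by positivity)
  have hqsq : √(a₂ / Real.pi) ^ 2 = a₂ / Real.pi := Real.sq_sqrt (by positivity)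
  have hRsq : √((a₁ + a₂) / Real.pi) ^ 2 = √(a₁ / Real.pi) ^ 2 + √(a₂ / Real.pi) ^ 2 := by
    rw [hrsq, hqsq, Real.sq_sqrt (by positivity)]; ring
  have hssq : √((a₂ - a₁) / Real.pi) ^ 2 = √(a₂ / Real.pi) ^ 2 - √(a₁ / Real.pi) ^ 2 := by
    rw [hrsq, hqsq, Real.sq_sqrt (div_nonneg (sub_nonneg.2 h₂) hπ.le)]; ring
  have hr := Real.sqrt_nonneg (a₁ / Real.pi)
  have hR := Real.sqrt_nonneg ((a₁ + a₂) / Real.pi)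
  have hs := Real.sqrt_nonneg ((a₂ - a₁) / Real.pi)
  have hleg := mul_le_one_add_sqrt_two_mul hr hrq hR hRsq
  have hhat := mul_sub_le_one_add_sqrt_two_mul hr hrq hR hs hRsq hssq
  have hsum := mul_add_le_two_mul_one_add_sqrt_two_mul hR hRsq
  set L := (1 + √2) * √((a₁ + a₂) / Real.pi)
  have small (p : Plane) (hp : p ∈ rightIsoHat a₁ 0) :=
    rightIsoTriangle_bounds (roundCorners_subset _ _ hp)
  have large (p : Plane) (hp : p ∈ rightIsoHat a₂ (a₂ - a₁)) :=
    rightIsoTriangle_bounds (roundCorners_subset _ _ hp)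
  refine ⟨IsometryEquiv.refl _, IsometryEquiv.subLeft (pt L L), ?_, ?_, ?_⟩
  · rintro _ ⟨p, hp, rfl⟩
    obtain ⟨h0, h1, h⟩ := small p hp
    exact ⟨⟨h0, show p 0 ≤ L by linarith⟩, h1, show p 1 ≤ L by linarith⟩
  · rintro _ ⟨p, hp, rfl⟩
    obtain ⟨h0, h1, -⟩ := large p hp
    have hp0 := apply_le_of_mem_roundCorners hs hp 0
    have hp1 := apply_le_of_mem_roundCorners hs hp 1
    simp only [closedSquare, Set.mem_ofPred_eq, Set.mem_Icc, IsometryEquiv.subLeft_apply,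
      PiLp.sub_apply, pt_zero, pt_one]
    refine ⟨⟨?_, ?_⟩, ?_, ?_⟩ <;> linarith
  · refine disjoint_interior_of_sum_le (u := (2 + √2) * √(a₁ / Real.pi))
      (v := 2 * L - (2 + √2) * √(a₂ / Real.pi)) (by linarith) ?_ ?_
    · rintro _ ⟨p, hp, rfl⟩
      exact (small p hp).2.2
    · rintro _ ⟨p, hp, rfl⟩
      have h := (large p hp).2.2
      simp only [IsometryEquiv.subLeft_apply, PiLp.sub_apply, pt_zero, pt_one]
      linarith
end
end

section
/- For all 0 ≤ b ≤ a and every closed non-acute triangle T ⊆ ℝ² whose incircle has area a, every finite multiset of positive real numbers whose sum is at most a and whose every element is at least b can be packed into the (a, b)-hat on T. ((a,b)-hats are 𝔺(a,b)-shapes.) -/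
noncomputable section

/-- A finite multiset of positive reals `C`, interpreted as circle areas, can be packed
into `S ⊆ ℝ²`: each area `a` gets a center such that the closed disk of radius `√(a/π)`
lies in `S`, and the open disks are pairwise disjoint. -/
def Packs (C : Multiset ℝ) (S : Set Plane) : Prop :=
  ∃ l : List (ℝ × Plane),
    (↑(l.map Prod.fst) : Multiset ℝ) = C ∧
    (∀ p ∈ l, Metric.closedBall p.2 (Real.sqrt (p.1 / Real.pi)) ⊆ S) ∧
    l.Pairwise fun p q =>
      Disjoint (Metric.ball p.2 (Real.sqrt (p.1 / Real.pi)))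
               (Metric.ball q.2 (Real.sqrt (q.1 / Real.pi)))

/-- Area of a triangle with side lengths `x, y, z` by Heron's formula. -/
def heronArea (x y z : ℝ) : ℝ :=
  Real.sqrt (((x + y + z) / 2) * ((x + y + z) / 2 - x) *
    ((x + y + z) / 2 - y) * ((x + y + z) / 2 - z))

/-- Area of the incircle of a triangle with side lengths `x, y, z`:
`π (Δ/s)²` where `Δ` is the area and `s` the semiperimeter. -/
def incircleArea (x y z : ℝ) : ℝ :=
  Real.pi * (heronArea x y z / ((x + y + z) / 2)) ^ 2

/-- The disk `p = (R, x, y)` of radius `R` around `(x, y)` lies in the triangle with base from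
`(0, 0)` to `(c, 0)` whose base angles have half-angle tangents `t` and `u`. -/
def DiskInTriangle (t u c : ℝ) (p : ℝ × ℝ × ℝ) : Prop :=
  p.1 ≤ p.2.2 ∧ (1 + t ^ 2) * p.1 ≤ 2 * t * p.2.1 - (1 - t ^ 2) * p.2.2 ∧
    (1 + u ^ 2) * p.1 ≤ 2 * u * (c - p.2.1) - (1 - u ^ 2) * p.2.2

/-- The disks `p = (R, x, y)` and `q = (R', x', y')` do not overlap. -/
def DisksApart (p q : ℝ × ℝ × ℝ) : Prop :=
  (p.1 + q.1) ^ 2 ≤ (p.2.1 - q.2.1) ^ 2 + (p.2.2 - q.2.2) ^ 2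

/-- The disks with radii in `D` can be packed into the triangle of inradius `r` whose base angles
have half-angle tangents `t` and `u`. -/
def PacksTriangle (t u r : ℝ) (D : Multiset ℝ) : Prop :=
  ∃ l : List (ℝ × ℝ × ℝ), (↑(l.map Prod.fst) : Multiset ℝ) = D ∧
    (∀ p ∈ l, DiskInTriangle t u (r * (1 / t + 1 / u)) p) ∧ l.Pairwise DisksApart

/-- Sum of the squares of the elements of a multiset. -/
def sumSq (D : Multiset ℝ) : ℝ := (D.map (· ^ 2)).sum

theorem sumSq_add (D E : Multiset ℝ) : sumSq (D + E) = sumSq D + sumSq E := by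
  simp [sumSq]

theorem sumSq_cons (x : ℝ) (D : Multiset ℝ) : sumSq (x ::ₘ D) = x ^ 2 + sumSq D := by
  simp [sumSq]

theorem sumSq_nonneg (D : Multiset ℝ) : 0 ≤ sumSq D :=
  Multiset.sum_nonneg (by simp only [Multiset.mem_map]; rintro _ ⟨x, _, rfl⟩; positivity)

/-- Greedy splitting of a sorted list in the ratio `f : g`. -/
theorem exists_split_of_sorted (f g : ℝ) (hf : 0 < f) (hg : 0 < g) (L : List ℝ)
    (hL : L.Pairwise (· ≤ ·)) (hpos : ∀ x ∈ L, 0 < x) :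
    ∃ D E : Multiset ℝ, D + E = ↑L ∧
      (∀ x ∈ D, g * sumSq D - f * sumSq E ≤ g * x ^ 2) ∧
      (∀ x ∈ E, f * sumSq E - g * sumSq D ≤ f * x ^ 2) := by
  induction L with
  | nil => exact ⟨0, 0, by simp⟩
  | cons c L ih =>
    rw [List.pairwise_cons] at hL
    obtain ⟨D, E, h, hD, hE⟩ := ih hL.2 fun x hx => hpos x (List.mem_cons_of_mem _ hx)
    have hc : 0 < c := hpos c (by simp)
    have hle : ∀ x ∈ D + E, c ^ 2 ≤ x ^ 2 := fun x hx => by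
      rw [h] at hx
      exact pow_le_pow_left₀ hc.le (hL.1 x (by simpa using hx)) 2
    have hc2 : 0 < c ^ 2 := by positivity
    rcases le_total (g * sumSq D) (f * sumSq E) with hlt | hlt
    · refine ⟨c ::ₘ D, E, by rw [Multiset.cons_add, h]; rfl, fun x hx => ?_, fun x hx => ?_⟩
      · have : c ^ 2 ≤ x ^ 2 := by
          rcases Multiset.mem_cons.1 hx with rfl | hx
          · exact le_rfl
          · exact hle x (by simp [hx])
        rw [sumSq_cons]
        nlinarith
      · have := hE x hx
        rw [sumSq_cons]
        nlinarith
    · refine ⟨D, c ::ₘ E, by rw [Multiset.add_cons, h]; rfl, fun x hx => ?_, fun x hx => ?_⟩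
      · have := hD x hx
        rw [sumSq_cons]
        nlinarith
      · have : c ^ 2 ≤ x ^ 2 := by
          rcases Multiset.mem_cons.1 hx with rfl | hx
          · exact le_rfl
          · exact hle x (by simp [hx])
        rw [sumSq_cons]
        nlinarith

theorem exists_split (f g : ℝ) (hf : 0 < f) (hg : 0 < g) (C : Multiset ℝ)
    (hpos : ∀ x ∈ C, 0 < x) :
    ∃ D E : Multiset ℝ, D + E = C ∧
      (∀ x ∈ D, g * sumSq D - f * sumSq E ≤ g * x ^ 2) ∧
      (∀ x ∈ E, f * sumSq E - g * sumSq D ≤ f * x ^ 2) := by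
  have := exists_split_of_sorted f g hf hg (C.sort (· ≤ ·)) (C.pairwise_sort (· ≤ ·))
    (fun x hx => hpos x (by simpa using hx))
  simpa using this

theorem ne_zero_of_split {D E : Multiset ℝ} (f g : ℝ) (hg : 0 < g)
    (hpos : ∀ x ∈ D + E, 0 < x) (hcard : 2 ≤ (D + E).card)
    (hD : ∀ x ∈ D, g * sumSq D - f * sumSq E ≤ g * x ^ 2) : E ≠ 0 := by
  rintro rfl
  rw [add_zero] at hcard hpos
  obtain ⟨x, hx⟩ := Multiset.card_pos_iff_exists_mem.1 (by omega : 0 < D.card)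
  obtain ⟨D, rfl⟩ := Multiset.exists_cons_of_mem hx
  rw [Multiset.card_cons] at hcard
  obtain ⟨y, hy⟩ := Multiset.card_pos_iff_exists_mem.1 (by omega : 0 < D.card)
  obtain ⟨D, rfl⟩ := Multiset.exists_cons_of_mem hy
  have hx' := hD x (by simp)
  have hy' : 0 < y := hpos y (by simp)
  have h0 : sumSq 0 = 0 := by simp [sumSq]
  rw [sumSq_cons, sumSq_cons, h0] at hx'
  have := sumSq_nonneg D
  have : 0 < g * (y ^ 2 + sumSq D) := by positivity
  nlinarith

theorem radius_bound (t u r ρ τ R : ℝ) (ht : 0 < t) (hu : 0 < u) (h : t + u + t * u ≤ 1)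
    (hr : 0 ≤ r) (hR : 0 < R) (hsum : ρ ^ 2 + τ ^ 2 ≤ r ^ 2)
    (hmin : (1 - u) ^ 2 * ρ ^ 2 - (1 - t) ^ 2 * τ ^ 2 ≤ (1 - u) ^ 2 * R ^ 2) :
    (1 - t * u) * ρ - (1 - t) * r ≤ t * (1 - u) * R := by
  have htu : 0 < t * u := mul_pos ht hu
  have hu1 : u < 1 := by linarith
  have ht1 : t < 1 := by linarith
  have hτ := sq_nonneg τ
  have hρr : ρ ≤ r := abs_le_of_sq_le_sq' (by linarith) hr |>.2
  rcases le_or_gt ((1 - t * u) * ρ) ((1 - t) * r) with hle | hlt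
  · have : 0 ≤ t * (1 - u) * R := by
      have : 0 ≤ 1 - u := by linarith
      positivity
    linarith
  have hN : (1 - t * u) ^ 2 ≤ (1 - u) ^ 2 + (1 - t) ^ 2 := by
    nlinarith [mul_nonneg (sub_nonneg.2 h) (by nlinarith : 0 ≤ 1 - t - u + t * u)]
  set N := (1 - u) ^ 2 + (1 - t) ^ 2 with hNdef
  have hlow : N * ρ ^ 2 - (1 - t) ^ 2 * r ^ 2 ≤ (1 - u) ^ 2 * R ^ 2 := by
    nlinarith [mul_le_mul_of_nonneg_left hsum (sq_nonneg (1 - t))]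
  have hkey : ((1 - t * u) * ρ - (1 - t) * r) ^ 2 ≤ t ^ 2 * (N * ρ ^ 2 - (1 - t) ^ 2 * r ^ 2) := by
    have hD : 0 < 1 - t * u := by nlinarith
    have hv : 0 < 1 - t := by linarith
    set P := (1 - t) * (2 * (1 - t * u) - (1 - t) * (1 + t ^ 2)) with hP
    have hPle : (1 - t * u) * (1 - t) * (1 + t ^ 2) ≤ P := by
      have : 0 ≤ (1 - t) ^ 2 * (1 - (t + u + t * u)) :=
        mul_nonneg (sq_nonneg _) (by linarith)
      have : 0 ≤ (1 - t) ^ 2 * (1 - (t + u + t * u)) * t := mul_nonneg this ht.le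
      rw [hP]
      linear_combination this
    have hfac : 0 ≤ P * ρ - (1 - t) ^ 2 * (1 + t ^ 2) * r := by
      refine nonneg_of_mul_nonneg_right ?_ hD
      have hP0 : 0 ≤ P := le_trans (by positivity) hPle
      have m1 := mul_le_mul_of_nonneg_left hlt.le hP0
      have m2 := mul_le_mul_of_nonneg_right hPle (mul_nonneg hv.le hr)
      linear_combination m1 + m2
    have := mul_nonneg (sub_nonneg.2 hρr) hfac
    rw [hP] at this
    rw [hNdef]
    linear_combination this
  refine abs_le_of_sq_le_sq' (hkey.trans ?_) ?_ |>.2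
  · nlinarith [mul_le_mul_of_nonneg_left hlow (sq_nonneg t)]
  · exact mul_nonneg (mul_nonneg ht.le (by linarith)) hR.le

/-- Packing a right triangle, reflected at an angle bisector, into the left half of a larger
non-acute triangle. -/
theorem exists_left_packing (t u r ρ τ : ℝ) (D : Multiset ℝ) (ht : 0 < t) (hu : 0 < u)
    (h : t + u + t * u ≤ 1) (hr : 0 ≤ r) (hsum : ρ ^ 2 + τ ^ 2 ≤ r ^ 2)
    (hpos : ∀ R ∈ D, 0 < R)
    (hmin : ∀ R ∈ D, (1 - u) ^ 2 * ρ ^ 2 - (1 - t) ^ 2 * τ ^ 2 ≤ (1 - u) ^ 2 * R ^ 2)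
    (hD : PacksTriangle t ((1 - t) / (1 + t)) ρ D) :
    ∃ l : List (ℝ × ℝ × ℝ), (↑(l.map Prod.fst) : Multiset ℝ) = D ∧
      (∀ p ∈ l, DiskInTriangle t u (r * (1 / t + 1 / u)) p ∧ p.2.1 + p.1 ≤ ρ * (1 + 1 / t)) ∧
      l.Pairwise DisksApart := by
  obtain ⟨l, hl, hin, hap⟩ := hD
  have htu : 0 < t * u := mul_pos ht hu
  have hu1 : u < 1 := by linarith
  have ht1 : t < 1 := by linarith
  have hq : 0 < 1 + t ^ 2 := by positivity
  set F : ℝ × ℝ × ℝ → ℝ × ℝ × ℝ := fun p =>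
    (p.1, ((1 - t ^ 2) * p.2.1 + 2 * t * p.2.2) / (1 + t ^ 2),
      (2 * t * p.2.1 - (1 - t ^ 2) * p.2.2) / (1 + t ^ 2)) with hF
  refine ⟨l.map F, ?_, ?_, ?_⟩
  · rw [List.map_map]
    exact hl
  · simp only [List.mem_map]
    rintro _ ⟨⟨R, x, y⟩, hp, rfl⟩
    have hRD : R ∈ D := by
      rw [← hl]
      exact Multiset.mem_coe.2 (List.mem_map.2 ⟨_, hp, rfl⟩)
    obtain ⟨h1, h2, h3⟩ := hin _ hp
    simp only at h1 h2 h3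
    have hb := radius_bound t u r ρ τ R ht hu h hr (hpos R hRD) hsum (hmin R hRD)
    simp only [hF, DiskInTriangle]
    obtain ⟨X, hX⟩ : ∃ X, X = ((1 - t ^ 2) * x + 2 * t * y) / (1 + t ^ 2) := ⟨_, rfl⟩
    obtain ⟨Y, hY⟩ : ∃ Y, Y = (2 * t * x - (1 - t ^ 2) * y) / (1 + t ^ 2) := ⟨_, rfl⟩
    rw [← hX, ← hY]
    have hYR : R ≤ Y := by
      rw [hY, le_div_iff₀ hq]
      linarith
    have hy : 2 * t * X - (1 - t ^ 2) * Y = (1 + t ^ 2) * y := by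
      rw [hX, hY]
      field_simp
      ring
    have hXm : X + R ≤ ρ * (1 + 1 / t) := by
      have e : (1 + ((1 - t) / (1 + t)) ^ 2) * R * (1 + t) ^ 2 / (1 + t ^ 2) = 2 * R := by
        field_simp
        ring
      have e' : (2 * ((1 - t) / (1 + t)) * (ρ * (1 / t + 1 / ((1 - t) / (1 + t))) - x) -
          (1 - ((1 - t) / (1 + t)) ^ 2) * y) * (1 + t) ^ 2 / (1 + t ^ 2)
          = 2 * (ρ * (1 + 1 / t) - X) := by
        have : 1 - t ≠ 0 := by linarith
        rw [hX]
        field_simp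
        ring
      have := div_le_div_of_nonneg_right
        (mul_le_mul_of_nonneg_right h3 (sq_nonneg (1 + t))) hq.le
      rw [e, e'] at this
      linarith
    refine ⟨⟨hYR, ?_, ?_⟩, hXm⟩
    · rw [hy]
      exact mul_le_mul_of_nonneg_left h1 hq.le
    · have ht2 : 0 < 1 - t ^ 2 := by nlinarith
      have hu2 : 0 < 1 - u ^ 2 := by nlinarith
      refine le_of_mul_le_mul_left ?_ ht2
      have k1 : (1 - u ^ 2) * ((1 + t ^ 2) * R) ≤
          (1 - u ^ 2) * (2 * t * X - (1 - t ^ 2) * Y) := by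
        rw [hy]
        exact mul_le_mul_of_nonneg_left (mul_le_mul_of_nonneg_left h1 hq.le) hu2.le
      have k2 : 2 * (t + u) * (1 - t * u) * (X + R) ≤
          2 * (t + u) * (1 - t * u) * (ρ * (1 + 1 / t)) :=
        mul_le_mul_of_nonneg_left hXm
          (mul_nonneg (by positivity) (by linarith))
      have k3 : 2 * (t + u) * ((1 + t) / t) * ((1 - t * u) * ρ - (1 - t) * r) ≤
          2 * (t + u) * ((1 + t) / t) * (t * (1 - u) * R) :=
        mul_le_mul_of_nonneg_left hb (by positivity)
      have e1 : 2 * (t + u) * ((1 + t) / t) * ((1 - t * u) * ρ - (1 - t) * r) =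
          2 * (t + u) * (1 - t * u) * (ρ * (1 + 1 / t))
            - (1 - t ^ 2) * (2 * u * (r * (1 / t + 1 / u))) := by
        field_simp
        ring
      have e2 : 2 * (t + u) * ((1 + t) / t) * (t * (1 - u) * R) =
          2 * (t + u) * (1 + t) * (1 - u) * R := by
        field_simp
      rw [e1, e2] at k3
      linear_combination k1 + k2 + k3
  · rw [List.pairwise_map]
    refine hap.imp fun {p q} hpq => ?_
    unfold DisksApart at hpq ⊢
    refine hpq.trans_eq ?_
    simp only [hF]
    field_simp
    ring

theorem base_bound (t u r ρ τ : ℝ) (ht : 0 < t) (hu : 0 < u) (h : t + u + t * u ≤ 1)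
    (hr : 0 ≤ r) (hsum : ρ ^ 2 + τ ^ 2 ≤ r ^ 2) :
    ρ * (1 + 1 / t) + τ * (1 + 1 / u) ≤ r * (1 / t + 1 / u) := by
  have hx : 0 < 1 / t := by positivity
  have hy : 0 < 1 / u := by positivity
  have hxy : 1 + 1 / t + 1 / u ≤ 1 / t * (1 / u) := by
    have : 1 / t * (1 / u) - (1 + 1 / t + 1 / u) = (1 - (t + u + t * u)) / (t * u) := by
      field_simp
      ring
    have : 0 ≤ (1 - (t + u + t * u)) / (t * u) := div_nonneg (by linarith) (by positivity)
    linarith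
  set x := 1 / t
  set y := 1 / u
  refine abs_le_of_sq_le_sq' ?_ (by positivity) |>.2
  calc (ρ * (1 + x) + τ * (1 + y)) ^ 2
      ≤ (ρ ^ 2 + τ ^ 2) * ((1 + x) ^ 2 + (1 + y) ^ 2) := by
        nlinarith [sq_nonneg (ρ * (1 + y) - τ * (1 + x))]
    _ ≤ r ^ 2 * (x + y) ^ 2 := by
        refine mul_le_mul hsum ?_ (by positivity) (by positivity)
        nlinarith
    _ = _ := by ring

/-- Disks of total squared radius at most `r ^ 2` pack into any non-acute triangle of
inradius `r`. -/
theorem packsTriangle_of_sumSq_le (n : ℕ) : ∀ (D : Multiset ℝ), D.card = n →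
    (∀ R ∈ D, 0 < R) → ∀ t u r : ℝ, 0 < t → 0 < u → t + u + t * u ≤ 1 → 0 ≤ r →
    sumSq D ≤ r ^ 2 → PacksTriangle t u r D := by
  induction n using Nat.strong_induction_on with
  | _ n ih =>
  intro C hn hpos t u r ht hu h hr hsum
  have htu : 0 < t * u := mul_pos ht hu
  have hu1 : u < 1 := by linarith
  have ht1 : t < 1 := by linarith
  rcases lt_or_ge n 2 with hlt | hge
  · interval_cases n
    · rw [Multiset.card_eq_zero] at hn
      subst hn
      exact ⟨[], by simp⟩
    · obtain ⟨R, rfl⟩ := Multiset.card_eq_one.1 hn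
      have hR : R ≤ r := by
        have : R ^ 2 ≤ r ^ 2 := by simpa [sumSq] using hsum
        exact abs_le_of_sq_le_sq' this hr |>.2
      refine ⟨[(R, r / t, r)], by simp, ?_, by simp⟩
      simp only [List.mem_singleton, forall_eq, DiskInTriangle]
      refine ⟨hR, ?_, ?_⟩
      · have : 2 * t * (r / t) - (1 - t ^ 2) * r = (1 + t ^ 2) * r := by
          field_simp
          ring
        rw [this]
        gcongr
      · have : 2 * u * (r * (1 / t + 1 / u) - r / t) - (1 - u ^ 2) * r = (1 + u ^ 2) * r := by
          field_simp
          ring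
        rw [this]
        gcongr
  obtain ⟨D, E, rfl, hD, hE⟩ := exists_split ((1 - t) ^ 2) ((1 - u) ^ 2)
    (by have : 0 < 1 - t := by linarith
        positivity)
    (by have : 0 < 1 - u := by linarith
        positivity) C hpos
  have hE0 : E ≠ 0 := ne_zero_of_split _ _ (by have : 0 < 1 - u := by linarith
                                               positivity) hpos (hn ▸ hge) hD
  have hD0 : D ≠ 0 := ne_zero_of_split _ _ (by have : 0 < 1 - t := by linarith
                                               positivity)
    (by rwa [add_comm]) (by rw [add_comm, hn]; exact hge) hE
  rw [← Multiset.card_pos] at hE0 hD0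
  rw [Multiset.card_add] at hn
  rw [sumSq_add] at hsum
  have hsD := Real.sq_sqrt (sumSq_nonneg D)
  have hsE := Real.sq_sqrt (sumSq_nonneg E)
  set ρ := √(sumSq D)
  set τ := √(sumSq E)
  rw [← hsD, ← hsE] at hsum hD hE
  have hright : ∀ v : ℝ, 0 < v → v < 1 → 0 < (1 - v) / (1 + v) ∧
      v + (1 - v) / (1 + v) + v * ((1 - v) / (1 + v)) ≤ 1 := fun v hv hv1 => by
    have : 0 < 1 - v := by linarith
    refine ⟨by positivity, le_of_eq ?_⟩
    field_simp
    ring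
  have hposD : ∀ R ∈ D, 0 < R := fun R hR => hpos R (by simp [hR])
  have hposE : ∀ R ∈ E, 0 < R := fun R hR => hpos R (by simp [hR])
  obtain ⟨l, hl, hlin, hlap⟩ := exists_left_packing t u r ρ τ D ht hu h hr
    hsum hposD hD (ih D.card (by omega) D rfl hposD t _ ρ ht (hright t ht ht1).1
      (hright t ht ht1).2 (Real.sqrt_nonneg _) hsD.ge)
  obtain ⟨m, hm, hmin, hmap⟩ := exists_left_packing u t r τ ρ E hu ht (by linarith) hr
    (by linarith) hposE hE
    (ih E.card (by omega) E rfl hposE u _ τ hu (hright u hu hu1).1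
      (hright u hu hu1).2 (Real.sqrt_nonneg _) hsE.ge)
  have hbase := base_bound t u r ρ τ ht hu h hr hsum
  rw [add_comm (1 / u)] at hmin
  set c := r * (1 / t + 1 / u)
  refine ⟨l ++ m.map fun p => (p.1, c - p.2.1, p.2.2), ?_, ?_, ?_⟩
  · rw [List.map_append, List.map_map, ← Multiset.coe_add, hl, ← hm]
    rfl
  · intro p hp
    rcases List.mem_append.1 hp with hp | hp
    · exact (hlin p hp).1
    · obtain ⟨q, hq, rfl⟩ := List.mem_map.1 hp
      obtain ⟨⟨h1, h2, h3⟩, -⟩ := hmin q hq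
      refine ⟨h1, h3, ?_⟩
      change _ ≤ 2 * u * (c - (c - q.2.1)) - _
      rw [sub_sub_cancel]
      exact h2
  · rw [List.pairwise_append, List.pairwise_map]
    refine ⟨hlap, hmap.imp fun {p q} hpq => ?_, fun p hp q hq => ?_⟩
    · unfold DisksApart at hpq ⊢
      refine hpq.trans_eq ?_
      simp only
      ring
    · obtain ⟨q, hq', rfl⟩ := List.mem_map.1 hq
      have h1 := (hlin p hp).2
      have h2 := (hmin q hq').2
      have hp0 : 0 < p.1 := hposD _ (by rw [← hl]; exact List.mem_map.2 ⟨_, hp, rfl⟩)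
      have hq0 : 0 < q.1 := hposE _ (by rw [← hm]; exact List.mem_map.2 ⟨_, hq', rfl⟩)
      unfold DisksApart
      simp only
      nlinarith [sq_nonneg (p.2.2 - q.2.2)]

theorem add_add_mul_le_one_of_nonacute (x y z p q : ℝ) (hx : 0 < x) (hy : 0 < y) (hz : 0 < z)
    (hp : 0 < p) (hq : 0 < q) (hpsq : p ^ 2 = x ^ 2 + y ^ 2) (hqsq : q ^ 2 = z ^ 2 + y ^ 2)
    (h : y ^ 2 ≤ x * z) :
    y / (p + x) + y / (q + z) + y / (p + x) * (y / (q + z)) ≤ 1 := by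
  have hqp : y * q ≤ p * z := by
    refine abs_le_of_sq_le_sq' ?_ (by positivity) |>.2
    rw [mul_pow, mul_pow, hpsq, hqsq]
    nlinarith [mul_le_mul h h (by positivity) (by positivity)]
  have hle : y / (p + x) ≤ z / (q + y) := by
    rw [div_le_div_iff₀ (by positivity) (by positivity)]
    nlinarith
  have hone : z / (q + y) + y / (q + z) + z / (q + y) * (y / (q + z)) = 1 := by
    field_simp
    linear_combination -hqsq
  have : y / (p + x) * (y / (q + z)) ≤ z / (q + y) * (y / (q + z)) :=
    mul_le_mul_of_nonneg_right hle (by positivity)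
  linarith

theorem incircleArea_eq (x y z p q : ℝ) (hc : 0 < x + z) (hp : 0 < p) (hq : 0 < q)
    (hpsq : p ^ 2 = x ^ 2 + y ^ 2) (hqsq : q ^ 2 = z ^ 2 + y ^ 2) :
    incircleArea (x + z) q p = Real.pi * ((x + z) * y / (p + q + (x + z))) ^ 2 := by
  have hprod : ((x + z) + q + p) / 2 * (((x + z) + q + p) / 2 - (x + z)) *
      (((x + z) + q + p) / 2 - q) * (((x + z) + q + p) / 2 - p) = ((x + z) * y / 2) ^ 2 := by
    have e : ((x + z) + q + p) / 2 * (((x + z) + q + p) / 2 - (x + z)) *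
      (((x + z) + q + p) / 2 - q) * (((x + z) + q + p) / 2 - p) =
      (4 * p ^ 2 * (x + z) ^ 2 - (p ^ 2 + (x + z) ^ 2 - q ^ 2) ^ 2) / 16 := by ring
    rw [e, hpsq, hqsq]
    ring
  unfold incircleArea heronArea
  rw [hprod, div_pow, Real.sq_sqrt (sq_nonneg _), ← div_pow]
  congr 2
  have : p + q + (x + z) ≠ 0 := by positivity
  have : x + z + q + p ≠ 0 := by positivity
  field_simp
  ring

theorem incircleArea_swap (x y z : ℝ) : incircleArea x y z = incircleArea x z y := by
  have e : x + z + y = x + y + z := by ring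
  unfold incircleArea heronArea
  rw [e]
  ring_nf

theorem incircleArea_rotate (x y z : ℝ) : incircleArea x y z = incircleArea y z x := by
  have e : y + z + x = x + y + z := by ring
  unfold incircleArea heronArea
  rw [e]
  ring_nf

theorem exists_frame (A B C : Plane) (hncol : ¬ Collinear ℝ ({A, B, C} : Set Plane)) :
    ∃ e f g k c x y : ℝ, 0 < c ∧ 0 < y ∧ e ^ 2 + f ^ 2 = 1 ∧ g ^ 2 + k ^ 2 = 1 ∧
      e * g + f * k = 0 ∧ B 0 = A 0 + c * e ∧ B 1 = A 1 + c * f ∧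
      C 0 = A 0 + x * e + y * g ∧ C 1 = A 1 + x * f + y * k := by
  have hAB : A ≠ B := by
    rintro rfl
    exact hncol (by simpa using collinear_pair ℝ A C)
  have hc : 0 < dist A B := dist_pos.2 hAB
  have hcsq : dist A B ^ 2 = (B 0 - A 0) ^ 2 + (B 1 - A 1) ^ 2 := by
    rw [EuclideanSpace.dist_eq, Real.sq_sqrt (by positivity), Fin.sum_univ_two,
      Real.dist_eq, Real.dist_eq, sq_abs, sq_abs]
    ring
  set c := dist A B
  obtain ⟨e, he⟩ : ∃ e, e = (B 0 - A 0) / c := ⟨_, rfl⟩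
  obtain ⟨f, hf⟩ : ∃ f, f = (B 1 - A 1) / c := ⟨_, rfl⟩
  have hef : e ^ 2 + f ^ 2 = 1 := by
    rw [he, hf, div_pow, div_pow, ← add_div, ← hcsq, div_self (by positivity)]
  have hB0 : B 0 = A 0 + c * e := by rw [he]; field_simp; ring
  have hB1 : B 1 = A 1 + c * f := by rw [hf]; field_simp; ring
  obtain ⟨x, hx⟩ : ∃ x, x = e * (C 0 - A 0) + f * (C 1 - A 1) := ⟨_, rfl⟩
  obtain ⟨w, hw⟩ : ∃ w, w = -f * (C 0 - A 0) + e * (C 1 - A 1) := ⟨_, rfl⟩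
  have hC0 : C 0 = A 0 + x * e - w * f := by
    rw [hx, hw]
    linear_combination (A 0 - C 0) * hef
  have hC1 : C 1 = A 1 + x * f + w * e := by
    rw [hx, hw]
    linear_combination (A 1 - C 1) * hef
  rcases lt_trichotomy w 0 with h | h | h
  · exact ⟨e, f, f, -e, c, x, -w, hc, by linarith, hef, by linarith, by ring, hB0, hB1,
      by linarith, by linarith⟩
  · refine absurd ?_ hncol
    rw [collinear_iff_of_mem (p₀ := A) (by simp)]
    refine ⟨B - A, ?_⟩
    simp only [Set.mem_insert_iff, Set.mem_singleton_iff, forall_eq_or_imp, forall_eq]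
    refine ⟨⟨0, by simp⟩, ⟨1, by simp⟩, ⟨x / c, ?_⟩⟩
    ext i
    fin_cases i
    · simp [hC0, hB0, h]
      field_simp
      ring
    · simp [hC1, hB1, h]
      field_simp
      ring
  · exact ⟨e, f, -f, e, c, x, w, hc, h, hef, by linarith, by ring, hB0, hB1,
      by linarith, by linarith⟩

theorem closedBall_subset_roundCorners {p : Plane} {R s : ℝ} {T : Set Plane} (hs : 0 ≤ s)
    (hsR : s ≤ R) (h : Metric.closedBall p R ⊆ T) :
    Metric.closedBall p R ⊆ roundCorners s T := by
  intro q hq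
  rw [Metric.mem_closedBall] at hq
  simp only [roundCorners, Set.mem_iUnion, Set.mem_ofPred_eq, exists_prop]
  rcases (hs.trans hsR).eq_or_lt with hR | hR
  · have hs0 : s = R := by linarith
    exact ⟨p, by rwa [hs0], by rw [Metric.mem_closedBall]; linarith⟩
  have hk1 : s / R ≤ 1 := (div_le_one hR).2 hsR
  have hk0 : 0 ≤ s / R := by positivity
  refine ⟨AffineMap.lineMap q p (s / R), fun z hz => h ?_, ?_⟩
  · rw [Metric.mem_closedBall] at hz ⊢
    have h1 := dist_triangle z (AffineMap.lineMap q p (s / R)) p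
    rw [dist_lineMap_right, Real.norm_of_nonneg (by linarith)] at h1
    have h2 : (1 - s / R) * dist q p ≤ (1 - s / R) * R :=
      mul_le_mul_of_nonneg_left hq (by linarith)
    have h3 : s / R * R = s := by field_simp
    linarith
  · rw [Metric.mem_closedBall, dist_left_lineMap, Real.norm_of_nonneg hk0]
    calc s / R * dist q p ≤ s / R * R := mul_le_mul_of_nonneg_left hq hk0
      _ = s := by field_simp

theorem le_add_of_sq_add_sq_le {α β m X Y R : ℝ} (hm : 0 ≤ m) (hR : 0 ≤ R)
    (hαβ : α ^ 2 + β ^ 2 = m ^ 2) (h : X ^ 2 + Y ^ 2 ≤ R ^ 2) : -(m * R) ≤ α * X + β * Y := by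
  refine abs_le_of_sq_le_sq' ?_ (by positivity) |>.1
  calc (α * X + β * Y) ^ 2 ≤ (α ^ 2 + β ^ 2) * (X ^ 2 + Y ^ 2) := by
        nlinarith [sq_nonneg (α * Y - β * X)]
    _ ≤ m ^ 2 * R ^ 2 := by
        rw [hαβ]
        exact mul_le_mul_of_nonneg_left h (sq_nonneg m)
    _ = _ := by ring

theorem closedBall_subset_triangle (A B C : Plane) (e f g k c x y p q : ℝ)
    (hc : 0 < c) (hy : 0 < y) (hef : e ^ 2 + f ^ 2 = 1) (hgk : g ^ 2 + k ^ 2 = 1)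
    (horth : e * g + f * k = 0) (hB0 : B 0 = A 0 + c * e) (hB1 : B 1 = A 1 + c * f)
    (hC0 : C 0 = A 0 + x * e + y * g) (hC1 : C 1 = A 1 + x * f + y * k)
    (hpx : 0 < p + x) (hqx : 0 < q + (c - x)) (hpsq : p ^ 2 = x ^ 2 + y ^ 2)
    (hqsq : q ^ 2 = (c - x) ^ 2 + y ^ 2) (R X Y : ℝ) (hR : 0 ≤ R)
    (h : DiskInTriangle (y / (p + x)) (y / (q + (c - x))) c (R, X, Y)) :
    Metric.closedBall (!₂[A 0 + X * e + Y * g, A 1 + X * f + Y * k] : Plane) R ⊆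
      convexHull ℝ ({A, B, C} : Set Plane) := by
  intro Q hQ
  obtain ⟨h1, h2, h3⟩ := h
  simp only at h1 h2 h3
  obtain ⟨X', hX'⟩ : ∃ X', X' = e * (Q 0 - A 0) + f * (Q 1 - A 1) := ⟨_, rfl⟩
  obtain ⟨Y', hY'⟩ : ∃ Y', Y' = g * (Q 0 - A 0) + k * (Q 1 - A 1) := ⟨_, rfl⟩
  have hdet : (e * k - f * g) ^ 2 = 1 := by
    linear_combination hef * (g ^ 2 + k ^ 2) + hgk - horth * (e * g + f * k)
  have hg : g = -f * (e * k - f * g) := by linear_combination -g * hef + e * horth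
  have hk : k = e * (e * k - f * g) := by linear_combination -k * hef + f * horth
  have heg : e ^ 2 + g ^ 2 = 1 := by
    linear_combination (g - f * (e * k - f * g)) * hg + f ^ 2 * hdet + hef
  have hfk : f ^ 2 + k ^ 2 = 1 := by linarith
  have hefgk : e * f + g * k = 0 := by
    linear_combination k * hg - f * (e * k - f * g) * hk - e * f * hdet
  have hQ0 : Q 0 = A 0 + X' * e + Y' * g := by
    rw [hX', hY']
    linear_combination (A 0 - Q 0) * heg + (A 1 - Q 1) * hefgk
  have hQ1 : Q 1 = A 1 + X' * f + Y' * k := by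
    rw [hX', hY']
    linear_combination (A 1 - Q 1) * hfk + (A 0 - Q 0) * hefgk
  have hdist : (X' - X) ^ 2 + (Y' - Y) ^ 2 ≤ R ^ 2 := by
    rw [Metric.mem_closedBall, EuclideanSpace.dist_eq, Real.sqrt_le_left hR,
      Fin.sum_univ_two, Real.dist_eq, Real.dist_eq, sq_abs, sq_abs] at hQ
    simp only [hQ0, hQ1, Matrix.cons_val_zero, Matrix.cons_val_one] at hQ
    refine le_trans (le_of_eq ?_) hQ
    linear_combination -(X' - X) ^ 2 * hef - (Y' - Y) ^ 2 * hgk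
      - 2 * (X' - X) * (Y' - Y) * horth
  set t := y / (p + x) with ht
  set u := y / (q + (c - x)) with hu
  have ht0 : 0 < t := by positivity
  have hu0 : 0 < u := by positivity
  have htx : (1 - t ^ 2) * y = 2 * t * x := by
    rw [ht]
    field_simp
    linear_combination hpsq
  have hux : (1 - u ^ 2) * y = 2 * u * (c - x) := by
    rw [hu]
    field_simp
    linear_combination hqsq
  have g1 : 0 ≤ Y' := by
    have := le_add_of_sq_add_sq_le (α := 0) (β := 1) (m := 1) zero_le_one hR (by norm_num) hdist
    linarith
  have g2 : 0 ≤ X' * y - Y' * x := by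
    have := le_add_of_sq_add_sq_le (α := 2 * t) (β := -(1 - t ^ 2)) (m := 1 + t ^ 2)
      (by positivity) hR (by ring) hdist
    have h' : 0 ≤ 2 * t * X' - (1 - t ^ 2) * Y' := by linarith
    refine nonneg_of_mul_nonneg_right (a := 2 * t) ?_ (by positivity)
    linear_combination y * h' - Y' * htx
  have g3 : 0 ≤ (c - X') * y - Y' * (c - x) := by
    have := le_add_of_sq_add_sq_le (α := -(2 * u)) (β := -(1 - u ^ 2)) (m := 1 + u ^ 2)
      (by positivity) hR (by ring) hdist
    have h' : 0 ≤ 2 * u * (c - X') - (1 - u ^ 2) * Y' := by linarith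
    refine nonneg_of_mul_nonneg_right (a := 2 * u) ?_ (by positivity)
    linear_combination y * h' - Y' * hux
  have hmem : ∑ i, ![((c - X') * y - Y' * (c - x)) / (c * y), (X' * y - Y' * x) / (c * y),
      Y' / y] i •
      ![A, B, C] i ∈ convexHull ℝ ({A, B, C} : Set Plane) := by
    refine (convex_convexHull ℝ _).sum_mem (fun i _ => ?_) ?_ (fun i _ => ?_)
    · fin_cases i
      · exact div_nonneg g3 (by positivity)
      · exact div_nonneg g2 (by positivity)
      · exact div_nonneg g1 hy.le
    · simp only [Fin.sum_univ_three, Matrix.cons_val]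
      field_simp
      ring
    · refine subset_convexHull ℝ _ ?_
      fin_cases i <;> simp
  convert hmem
  ext i
  fin_cases i
  · simp [Fin.sum_univ_three, hQ0, hB0, hC0]
    field_simp
    ring
  · simp [Fin.sum_univ_three, hQ1, hB1, hC1]
    field_simp
    ring

theorem packs_of_nonacute (A B C : Plane)
    (hncol : ¬ Collinear ℝ ({A, B, C} : Set Plane))
    (hang : Real.pi / 2 ≤ EuclideanGeometry.angle A C B) (a b : ℝ)
    (ha : a = incircleArea (dist A B) (dist B C) (dist C A)) (M : Multiset ℝ)
    (hpos : ∀ m ∈ M, 0 < m) (hsum : M.sum ≤ a) (hmin : ∀ m ∈ M, b ≤ m) :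
    Packs M (roundCorners (Real.sqrt (b / Real.pi))
      (convexHull ℝ ({A, B, C} : Set Plane))) := by
  obtain ⟨e, f, g, k, c, x, y, hc, hy, hef, hgk, horth, hB0, hB1, hC0, hC1⟩ :=
    exists_frame A B C hncol
  have hdist : ∀ P Q : Plane, dist P Q = √((P 0 - Q 0) ^ 2 + (P 1 - Q 1) ^ 2) := fun P Q => by
    rw [EuclideanSpace.dist_eq, Fin.sum_univ_two, Real.dist_eq, Real.dist_eq, sq_abs, sq_abs]
  have hAB : dist A B = x + (c - x) := by
    rw [hdist, hB0, hB1, Real.sqrt_eq_iff_eq_sq (by positivity) (by linarith)]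
    linear_combination c ^ 2 * hef
  have hpsq : dist C A ^ 2 = x ^ 2 + y ^ 2 := by
    rw [hdist, Real.sq_sqrt (by positivity), hC0, hC1]
    linear_combination x ^ 2 * hef + y ^ 2 * hgk + 2 * x * y * horth
  have hqsq : dist B C ^ 2 = (c - x) ^ 2 + y ^ 2 := by
    rw [hdist, Real.sq_sqrt (by positivity), hC0, hC1, hB0, hB1]
    linear_combination (c - x) ^ 2 * hef + y ^ 2 * hgk - 2 * (c - x) * y * horth
  have hp : 0 < dist C A := by
    refine lt_of_le_of_ne dist_nonneg fun h => ?_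
    rw [← h] at hpsq
    nlinarith
  have hq : 0 < dist B C := by
    refine lt_of_le_of_ne dist_nonneg fun h => ?_
    rw [← h] at hqsq
    nlinarith [sq_nonneg (c - x)]
  have hinner : y ^ 2 ≤ x * (c - x) := by
    have h1 : inner ℝ (A -ᵥ C) (B -ᵥ C) ≤ 0 := by
      rw [← InnerProductGeometry.cos_angle_mul_norm_mul_norm]
      refine mul_nonpos_of_nonpos_of_nonneg ?_ (by positivity)
      refine Real.cos_nonpos_of_pi_div_two_le_of_le hang ?_
      have := InnerProductGeometry.angle_le_pi (A -ᵥ C) (B -ᵥ C)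
      linarith [Real.pi_pos]
    simp only [vsub_eq_sub, PiLp.inner_apply, Fin.sum_univ_two, PiLp.sub_apply,
      RCLike.inner_apply, conj_trivial, hB0, hB1, hC0, hC1] at h1
    linear_combination h1 + (x * (c - x)) * hef - y ^ 2 * hgk + (c - 2 * x) * y * horth
  have hxz : 0 < x * (c - x) := lt_of_lt_of_le (by positivity) hinner
  have hx : 0 < x := by
    by_contra hx
    nlinarith
  have hz : 0 < c - x := (mul_pos_iff_of_pos_left hx).1 hxz
  rw [hAB, incircleArea_eq x y (c - x) _ _ (by linarith) hp hq hpsq hqsq] at ha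
  set p := dist C A
  set q := dist B C
  have htu := add_add_mul_le_one_of_nonacute x y (c - x) p q hx hy hz hp hq hpsq hqsq hinner
  have ht0 : 0 < y / (p + x) := by positivity
  have hu0 : 0 < y / (q + (c - x)) := by positivity
  rw [show x + (c - x) = c by ring] at ha
  set r := c * y / (p + q + c) with hr
  have hr0 : 0 ≤ r := by positivity
  have hπ := Real.pi_pos
  have hcr : r * (1 / (y / (p + x)) + 1 / (y / (q + (c - x)))) = c := by
    rw [hr]
    field_simp
    ring
  set N := M.map fun m => √(m / Real.pi) with hN
  obtain ⟨l, hl, hin, hap⟩ := packsTriangle_of_sumSq_le _ N rfl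
    (by
      simp only [hN, Multiset.mem_map]
      rintro _ ⟨m, hm, rfl⟩
      have := hpos m hm
      positivity) _ _ r ht0 hu0 htu hr0
    (by
      have e : sumSq N = M.sum / Real.pi := by
        rw [sumSq, hN, Multiset.map_map, div_eq_mul_inv]
        nth_rewrite 2 [← Multiset.map_id M]
        rw [← Multiset.sum_map_mul_right]
        refine congrArg _ (Multiset.map_congr rfl fun m hm => ?_)
        have := hpos m hm
        exact Real.sq_sqrt (by positivity)
      rw [e, div_le_iff₀ hπ]
      linarith)
  rw [hcr] at hin
  have hmem : ∀ P ∈ l, ∃ m ∈ M, √(m / Real.pi) = P.1 := fun P hP => by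
    have : P.1 ∈ N := by
      rw [← hl]
      exact List.mem_map.2 ⟨P, hP, rfl⟩
    simpa [hN] using this
  have hsqrt : ∀ P ∈ l, √(Real.pi * P.1 ^ 2 / Real.pi) = P.1 := fun P hP => by
    obtain ⟨m, -, hm⟩ := hmem P hP
    rw [mul_div_cancel_left₀ _ hπ.ne', Real.sqrt_sq (hm ▸ Real.sqrt_nonneg _)]
  refine ⟨l.map fun P => (Real.pi * P.1 ^ 2,
    (!₂[A 0 + P.2.1 * e + P.2.2 * g, A 1 + P.2.1 * f + P.2.2 * k] : Plane)), ?_, ?_, ?_⟩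
  · have : (↑((l.map Prod.fst).map fun R => Real.pi * R ^ 2) : Multiset ℝ) = M := by
      rw [← Multiset.map_coe, hl, hN, Multiset.map_map]
      refine (Multiset.map_congr rfl fun m hm => ?_).trans (Multiset.map_id M)
      have := hpos m hm
      simp only [Function.comp, id]
      rw [Real.sq_sqrt (by positivity)]
      field_simp
    rw [← this, List.map_map, List.map_map]
    rfl
  · simp only [List.mem_map]
    rintro _ ⟨P, hP, rfl⟩
    simp only
    rw [hsqrt P hP]
    obtain ⟨m, hmM, hm⟩ := hmem P hP
    refine closedBall_subset_roundCorners (Real.sqrt_nonneg _) ?_ ?_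
    · rw [← hm]
      exact Real.sqrt_le_sqrt (div_le_div_of_nonneg_right (hmin m hmM) hπ.le)
    · exact closedBall_subset_triangle A B C e f g k c x y p q hc hy hef hgk horth hB0 hB1 hC0
        hC1 (by positivity) (by positivity) hpsq hqsq _ _ _ (hm ▸ Real.sqrt_nonneg _) (hin P hP)
  · rw [List.pairwise_map]
    refine List.Pairwise.imp_of_mem (fun {P Q} hP hQ hPQ => ?_) hap
    simp only
    rw [hsqrt P hP, hsqrt Q hQ]
    refine Metric.ball_disjoint_ball ?_
    rw [hdist]
    refine Real.le_sqrt_of_sq_le (hPQ.trans_eq ?_)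
    simp only [Matrix.cons_val_zero, Matrix.cons_val_one]
    linear_combination -(P.2.1 - Q.2.1) ^ 2 * hef - (P.2.2 - Q.2.2) ^ 2 * hgk
      - 2 * (P.2.1 - Q.2.1) * (P.2.2 - Q.2.2) * horth

/-- `(a,b)`-hats on non-acute triangles are `𝔺(a,b)`-shapes: every finite multiset of
positive reals with sum at most `a` (the triangle's incircle area) and all elements at
least `b` can be packed into the `(a,b)`-hat on the triangle. -/
theorem hat_is_CShape (p₁ p₂ p₃ : Plane)
    (hncol : ¬ Collinear ℝ ({p₁, p₂, p₃} : Set Plane))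
    (hnonacute : Real.pi / 2 ≤ EuclideanGeometry.angle p₂ p₁ p₃ ∨
      Real.pi / 2 ≤ EuclideanGeometry.angle p₁ p₂ p₃ ∨
      Real.pi / 2 ≤ EuclideanGeometry.angle p₁ p₃ p₂)
    (a b : ℝ) (ha : a = incircleArea (dist p₁ p₂) (dist p₂ p₃) (dist p₃ p₁))
    (hb : 0 ≤ b) (hba : b ≤ a)
    (C : Multiset ℝ) (hpos : ∀ c ∈ C, 0 < c) (hsum : C.sum ≤ a)
    (hmin : ∀ c ∈ C, b ≤ c) :
    Packs C (roundCorners (Real.sqrt (b / Real.pi))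
      (convexHull ℝ ({p₁, p₂, p₃} : Set Plane))) := by
  rcases hnonacute with h | h | h
  · have e : ({p₁, p₂, p₃} : Set Plane) = {p₂, p₃, p₁} := by
      rw [Set.insert_comm, Set.pair_comm p₁]
    rw [e] at hncol ⊢
    rw [incircleArea_rotate] at ha
    exact packs_of_nonacute p₂ p₃ p₁ hncol h a b ha C hpos hsum hmin
  · have e : ({p₁, p₂, p₃} : Set Plane) = {p₁, p₃, p₂} := by
      rw [Set.pair_comm p₂]
    rw [e] at hncol ⊢
    rw [incircleArea_swap, incircleArea_rotate, incircleArea_rotate, incircleArea_swap,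
      incircleArea_rotate, incircleArea_swap] at ha
    rw [dist_comm p₃ p₁, dist_comm p₂ p₃, dist_comm p₁ p₂] at ha
    exact packs_of_nonacute p₁ p₃ p₂ hncol h a b ha C hpos hsum hmin
  · exact packs_of_nonacute p₁ p₂ p₃ hncol h a b ha C hpos hsum hmin
end
end
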